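/- arXiv:2408.12482 — 7 statements merged into one kernel-verified Lean document; each statement's English description precedes it below -/
import Mathlib

section
/- Let d ≥ 1, let L, U, L', U' be real d×d matrices with L'_{ij} ≤ L_{ij} ≤ 0 ≤ U_{ij} ≤ U'_{ij} for all i, j. Let S be a set of pairs of real d×d matrices, let f : S → ℝ be any function, and suppose (Â, B̂) ∈ S is the unique minimizer over S of F₁(A,B) = f(A,B) + ‖A‖_{LU}. Assume moreover that for all i, j: if Â_{ij} > 0 then U'_{ij} = U_{ij}, and if Â_{ij} < 0 then L'_{ij} = L_{ij}. Then (Â, B̂) is the unique minimizer over S of F₂(A,B) = f(A,B) + ‖A‖_{L'U'}. -/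
/-- The Golazo penalty `‖K‖_{LU} = ∑_{i,j} max {L i j * K i j, U i j * K i j}`. -/
noncomputable def golazo {d : ℕ} (L U K : Matrix (Fin d) (Fin d) ℝ) : ℝ :=
  ∑ i, ∑ j, max (L i j * K i j) (U i j * K i j)

theorem golazo_mono {d : ℕ} {L U L' U' : Matrix (Fin d) (Fin d) ℝ}
    (hL'L : ∀ i j, L' i j ≤ L i j) (hLU : ∀ i j, L i j ≤ U i j)
    (hUU' : ∀ i j, U i j ≤ U' i j) (K : Matrix (Fin d) (Fin d) ℝ) :
    golazo L U K ≤ golazo L' U' K := by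
  refine Finset.sum_le_sum fun i _ => Finset.sum_le_sum fun j _ => ?_
  rcases le_total 0 (K i j) with hK | hK
  · exact (max_le (mul_le_mul_of_nonneg_right (hLU i j) hK) le_rfl).trans
      ((mul_le_mul_of_nonneg_right (hUU' i j) hK).trans (le_max_right _ _))
  · exact (max_le le_rfl (mul_le_mul_of_nonpos_right (hLU i j) hK)).trans
      ((mul_le_mul_of_nonpos_right (hL'L i j) hK).trans (le_max_left _ _))

theorem golazo_congr_of_sign {d : ℕ} {L U L' U' K : Matrix (Fin d) (Fin d) ℝ}
    (hLU : ∀ i j, L i j ≤ U i j) (hLU' : ∀ i j, L' i j ≤ U' i j)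
    (hpos : ∀ i j, 0 < K i j → U' i j = U i j)
    (hneg : ∀ i j, K i j < 0 → L' i j = L i j) :
    golazo L' U' K = golazo L U K := by
  refine Finset.sum_congr rfl fun i _ => Finset.sum_congr rfl fun j _ => ?_
  rcases lt_trichotomy (K i j) 0 with hK | hK | hK
  · rw [max_eq_left (mul_le_mul_of_nonpos_right (hLU i j) hK.le),
      max_eq_left (mul_le_mul_of_nonpos_right (hLU' i j) hK.le), hneg i j hK]
  · simp [hK]
  · rw [max_eq_right (mul_le_mul_of_nonneg_right (hLU i j) hK.le),
      max_eq_right (mul_le_mul_of_nonneg_right (hLU' i j) hK.le), hpos i j hK]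

/-- Increasing the Golazo penalty only at entries whose sign differs from the optimizer's
sign pattern preserves the unique optimum. -/
theorem unique_min_golazo_stable {d : ℕ} (hd : 1 ≤ d)
    (L U L' U' : Matrix (Fin d) (Fin d) ℝ)
    (hL'L : ∀ i j, L' i j ≤ L i j) (hL : ∀ i j, L i j ≤ 0)
    (hU : ∀ i j, 0 ≤ U i j) (hUU' : ∀ i j, U i j ≤ U' i j)
    (S : Set (Matrix (Fin d) (Fin d) ℝ × Matrix (Fin d) (Fin d) ℝ))
    (f : Matrix (Fin d) (Fin d) ℝ × Matrix (Fin d) (Fin d) ℝ → ℝ)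
    (Ahat Bhat : Matrix (Fin d) (Fin d) ℝ)
    (hmem : (Ahat, Bhat) ∈ S)
    (hmin : ∀ p ∈ S, p ≠ (Ahat, Bhat) →
      f (Ahat, Bhat) + golazo L U Ahat < f p + golazo L U p.1)
    (hpos : ∀ i j, 0 < Ahat i j → U' i j = U i j)
    (hneg : ∀ i j, Ahat i j < 0 → L' i j = L i j) :
    (Ahat, Bhat) ∈ S ∧ ∀ p ∈ S, p ≠ (Ahat, Bhat) →
      f (Ahat, Bhat) + golazo L' U' Ahat < f p + golazo L' U' p.1 := by
  have hLU : ∀ i j, L i j ≤ U i j := fun i j => (hL i j).trans (hU i j)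
  have hLU' : ∀ i j, L' i j ≤ U' i j := fun i j =>
    (hL'L i j).trans ((hLU i j).trans (hUU' i j))
  refine ⟨hmem, fun p hp hne => ?_⟩
  rw [golazo_congr_of_sign hLU hLU' hpos hneg]
  exact (hmin p hp hne).trans_le (by gcongr; exact golazo_mono hL'L hLU hUU' p.1)
end

section
/- Let S be a symmetric real d×d matrix, λ ≥ 0 a real number, and L, U real d×d matrices with L_{ij} ≤ 0 ≤ U_{ij} for all i, j. Then the set C = {(A, B) : A, B symmetric real d×d matrices, A − B positive definite, B positive semidefinite} is convex, and the function F(A, B) = −log det(A − B) + tr((A − B) S) + ‖A‖_{LU} + λ tr(B) is convex on C. -/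
open Matrix

open scoped MatrixOrder in
/-- A real positive definite matrix is a Gram matrix `Cᴴ * C` with `C` invertible. -/
theorem Matrix.PosDef.exists_isUnit_conjTranspose_mul_self {n : Type*} [Fintype n]
    [DecidableEq n] {M : Matrix n n ℝ} (hM : M.PosDef) :
    ∃ C : Matrix n n ℝ, IsUnit C ∧ M = Cᴴ * C :=
  CStarAlgebra.isStrictlyPositive_iff_eq_star_mul_self.mp hM.isStrictlyPositive

theorem Matrix.PosDef.log_det_le_trace_sub_card {n : Type*} [Fintype n] [DecidableEq n]
    {M : Matrix n n ℝ} (hM : M.PosDef) :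
    Real.log M.det ≤ M.trace - Fintype.card n := by
  have hdet : M.det = ∏ i, hM.1.eigenvalues i := hM.1.det_eq_prod_eigenvalues
  have htr : M.trace = ∑ i, hM.1.eigenvalues i := hM.1.trace_eq_sum_eigenvalues
  rw [hdet, htr, Real.log_prod fun i _ => (hM.eigenvalues_pos i).ne']
  calc ∑ i, Real.log (hM.1.eigenvalues i) ≤ ∑ i, (hM.1.eigenvalues i - 1) :=
        Finset.sum_le_sum fun i _ => Real.log_le_sub_one_of_pos (hM.eigenvalues_pos i)
    _ = _ := by simp

/-- The graph of `log det` lies below its tangent hyperplane at a positive definite `Z`. -/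
theorem Matrix.PosDef.log_det_le_log_det_add_trace {n : Type*} [Fintype n] [DecidableEq n]
    {Z X : Matrix n n ℝ} (hZ : Z.PosDef) (hX : X.PosDef) :
    Real.log X.det ≤ Real.log Z.det + (Z⁻¹ * X).trace - Fintype.card n := by
  obtain ⟨C, hC, hZC⟩ := hZ.inv.exists_isUnit_conjTranspose_mul_self
  have hM : (C * X * Cᴴ).PosDef :=
    hX.mul_mul_conjTranspose_same (vecMul_injective_iff_isUnit.mpr hC)
  have hdet : (C * X * Cᴴ).det = Z.det⁻¹ * X.det := by
    have h : Z.det⁻¹ = Cᴴ.det * C.det := by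
      rw [← det_mul, ← hZC, det_nonsing_inv, Ring.inverse_eq_inv']
    rw [h, det_mul, det_mul]
    ring
  have htr : (C * X * Cᴴ).trace = (Z⁻¹ * X).trace := by
    rw [hZC, trace_mul_comm, Matrix.mul_assoc]
  have h := hM.log_det_le_trace_sub_card
  rw [hdet, htr, Real.log_mul (inv_ne_zero hZ.det_pos.ne') hX.det_pos.ne', Real.log_inv] at h
  linarith

theorem convex_setOf_posDef (n : Type*) [Fintype n] :
    Convex ℝ {X : Matrix n n ℝ | X.PosDef} :=
  convex_iff_forall_pos.mpr fun _ hX _ hY _ _ ha hb _ => (hX.smul ha).add (hY.smul hb)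

theorem concaveOn_log_det (n : Type*) [Fintype n] [DecidableEq n] :
    ConcaveOn ℝ {X : Matrix n n ℝ | X.PosDef} fun X => Real.log X.det := by
  refine ⟨convex_setOf_posDef n, fun X hX Y hY a b ha hb hab => ?_⟩
  have hZ : (a • X + b • Y).PosDef := convex_setOf_posDef n hX hY ha hb hab
  have htr : a * ((a • X + b • Y)⁻¹ * X).trace + b * ((a • X + b • Y)⁻¹ * Y).trace
      = Fintype.card n := by
    have h := congrArg trace (nonsing_inv_mul _ hZ.det_pos.ne'.isUnit)
    rwa [Matrix.mul_add, Matrix.mul_smul, Matrix.mul_smul, trace_add, trace_smul, trace_smul,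
      trace_one] at h
  have h₁ := mul_le_mul_of_nonneg_left (hZ.log_det_le_log_det_add_trace hX) ha
  have h₂ := mul_le_mul_of_nonneg_left (hZ.log_det_le_log_det_add_trace hY) hb
  simp only [smul_eq_mul]
  obtain rfl : b = 1 - a := by linarith
  linarith

theorem convexOn_golazo {d : ℕ} (L U : Matrix (Fin d) (Fin d) ℝ) :
    ConvexOn ℝ Set.univ (golazo L U) := by
  refine ⟨convex_univ, fun X _ Y _ a b ha hb _ => ?_⟩
  simp only [golazo, smul_eq_mul, Finset.mul_sum, ← Finset.sum_add_distrib]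
  refine Finset.sum_le_sum fun i _ => Finset.sum_le_sum fun j _ => ?_
  simp only [Matrix.add_apply, Matrix.smul_apply, smul_eq_mul]
  rw [mul_max_of_nonneg _ _ ha, mul_max_of_nonneg _ _ hb]
  refine le_of_eq_of_le ?_ max_add_add_le_max_add_max
  congr 1 <;> ring

/-- The latent Gaussian graphical model objective with Golazo penalty is convex on the
convex set of pairs `(A, B)` of symmetric matrices with `A - B` positive definite and
`B` positive semidefinite. -/
theorem latent_golazo_objective_convex {d : ℕ} (S : Matrix (Fin d) (Fin d) ℝ)
    (hS : S.IsSymm) (lam : ℝ) (hlam : 0 ≤ lam)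
    (L U : Matrix (Fin d) (Fin d) ℝ)
    (hL : ∀ i j, L i j ≤ 0) (hU : ∀ i j, 0 ≤ U i j) :
    Convex ℝ {p : Matrix (Fin d) (Fin d) ℝ × Matrix (Fin d) (Fin d) ℝ |
        p.1.IsSymm ∧ p.2.IsSymm ∧ (p.1 - p.2).PosDef ∧ p.2.PosSemidef} ∧
    ConvexOn ℝ {p : Matrix (Fin d) (Fin d) ℝ × Matrix (Fin d) (Fin d) ℝ |
        p.1.IsSymm ∧ p.2.IsSymm ∧ (p.1 - p.2).PosDef ∧ p.2.PosSemidef}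
      (fun p => -Real.log (p.1 - p.2).det + ((p.1 - p.2) * S).trace
        + golazo L U p.1 + lam * p.2.trace) := by
  have hsub (p q : Matrix (Fin d) (Fin d) ℝ × Matrix (Fin d) (Fin d) ℝ) (a b : ℝ) :
      (a • p + b • q).1 - (a • p + b • q).2 = a • (p.1 - p.2) + b • (q.1 - q.2) := by
    simp only [Prod.fst_add, Prod.snd_add, Prod.smul_fst, Prod.smul_snd, smul_sub]
    abel
  have hconv : Convex ℝ {p : Matrix (Fin d) (Fin d) ℝ × Matrix (Fin d) (Fin d) ℝ |
      p.1.IsSymm ∧ p.2.IsSymm ∧ (p.1 - p.2).PosDef ∧ p.2.PosSemidef} := by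
    rintro p ⟨hp₁, hp₂, hp, hp'⟩ q ⟨hq₁, hq₂, hq, hq'⟩ a b ha hb hab
    refine ⟨(hp₁.smul a).add (hq₁.smul b), (hp₂.smul a).add (hq₂.smul b), ?_,
      (hp'.smul ha).add (hq'.smul hb)⟩
    rw [hsub]
    exact convex_setOf_posDef (Fin d) hp hq ha hb hab
  refine ⟨hconv, hconv, fun p hp q hq a b ha hb hab => ?_⟩
  have hlog := (concaveOn_log_det (Fin d)).2 hp.2.2.1 hq.2.2.1 ha hb hab
  have hgol := (convexOn_golazo L U).2 (Set.mem_univ p.1) (Set.mem_univ q.1) ha hb hab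
  simp only [hsub]
  simp only [Prod.fst_add, Prod.snd_add, Prod.smul_fst, Prod.smul_snd, Matrix.add_mul,
    Matrix.smul_mul, trace_add, trace_smul, smul_eq_mul] at hlog hgol ⊢
  linarith
end

section
/- Let V be a symmetric real d×d matrix with eigendecomposition V = C diag(v) C^T, where C is an orthogonal d×d matrix and v ∈ ℝ^d. Let c > 0 and define x ∈ ℝ^d by x_i = (−v_i + √(v_i² + 4c)) / (2c). Then M = C diag(x) C^T is symmetric positive definite and satisfies the quadratic matrix equation c M² + V M − I = 0. -/
open Matrix

/-- The larger root of `c x² + v x − 1` is positive when `c` is. -/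
theorem quadratic_root_pos {c : ℝ} (hc : 0 < c) (v : ℝ) :
    0 < (-v + Real.sqrt (v ^ 2 + 4 * c)) / (2 * c) := by
  have h : v < Real.sqrt (v ^ 2 + 4 * c) := Real.lt_sqrt_of_sq_lt (by linarith)
  exact div_pos (by linarith) (by linarith)

/-- The larger root of `c x² + v x − 1` is a root when `c` is positive. -/
theorem quadratic_root_eq {c : ℝ} (hc : 0 < c) (v : ℝ) :
    c * ((-v + Real.sqrt (v ^ 2 + 4 * c)) / (2 * c)) ^ 2 +
      v * ((-v + Real.sqrt (v ^ 2 + 4 * c)) / (2 * c)) = 1 := by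
  have h : Real.sqrt (v ^ 2 + 4 * c) ^ 2 = v ^ 2 + 4 * c := Real.sq_sqrt (by positivity)
  generalize Real.sqrt (v ^ 2 + 4 * c) = s at h ⊢
  field_simp
  linear_combination h

/-- Given an eigendecomposition `V = C diag(v) Cᵀ` of a symmetric matrix and `c > 0`, the matrix
`M = C diag(x) Cᵀ` with `x i` the positive root of `c x² + v i x − 1 = 0` is symmetric positive
definite and solves the quadratic matrix equation `c M² + V M − I = 0`. -/
theorem quadratic_matrix_solution {d : ℕ} (V C : Matrix (Fin d) (Fin d) ℝ) (v : Fin d → ℝ)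
    (hV : V.IsSymm) (hC : C * Cᵀ = 1) (hC' : Cᵀ * C = 1)
    (hdecomp : V = C * diagonal v * Cᵀ)
    (c : ℝ) (hc : 0 < c)
    (x : Fin d → ℝ) (hx : ∀ i, x i = (-v i + Real.sqrt (v i ^ 2 + 4 * c)) / (2 * c))
    (M : Matrix (Fin d) (Fin d) ℝ) (hM : M = C * diagonal x * Cᵀ) :
    M.PosDef ∧ c • M ^ 2 + V * M - 1 = 0 := by
  have hinj : Function.Injective C.vecMul :=
    vecMul_injective_of_isUnit (IsUnit.of_mul_eq_one Cᵀ hC)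
  have hpos : ∀ i, 0 < x i := fun i => hx i ▸ quadratic_root_pos hc (v i)
  have hmul : ∀ a b : Fin d → ℝ,
      C * diagonal a * Cᵀ * (C * diagonal b * Cᵀ) = C * diagonal (fun i => a i * b i) * Cᵀ := by
    intro a b
    rw [← diagonal_mul_diagonal]
    simp only [Matrix.mul_assoc]
    rw [← Matrix.mul_assoc Cᵀ C, hC', Matrix.one_mul]
  have hdiag : c • diagonal (fun i => x i * x i) + diagonal (fun i => v i * x i) =
      (1 : Matrix (Fin d) (Fin d) ℝ) := by
    rw [← diagonal_smul, diagonal_add, ← diagonal_one]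
    congr 1
    funext i
    have h := quadratic_root_eq hc (v i)
    rw [← hx i, sq] at h
    simpa using h
  refine ⟨?_, ?_⟩
  · have h := (PosDef.diagonal hpos).mul_mul_conjTranspose_same hinj
    rwa [conjTranspose_eq_transpose_of_trivial, ← hM] at h
  · rw [sub_eq_zero, hdecomp, hM, sq, hmul, hmul, ← Matrix.smul_mul, ← Matrix.mul_smul,
      ← Matrix.add_mul, ← Matrix.mul_add, hdiag, Matrix.mul_one, hC]
end

section
/- Let S, E, M₀ be symmetric real d×d matrices, let σ > 0 and ρ ≥ 0 be real numbers, and set c = (ρ+1)σ. Let V = S − σE − ρσM₀ and let V = C diag(v) C^T be an eigendecomposition with C orthogonal. Define x_i = (−v_i + √(v_i² + 4c)) / (2c) and M = C diag(x) C^T. Then M is the unique minimizer over the set of symmetric positive definite real d×d matrices of the function g(N) = −log det N + tr(N S) + (σ/2)‖N − E‖_F² + (ρσ/2)‖N − M₀‖_F². -/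
open Matrix

/-- For a positive definite matrix, `log det P ≤ tr P - n`. -/
theorem Matrix.PosDef.log_det_le_trace_sub_card_s9 {n : Type*} [Fintype n] [DecidableEq n]
    {P : Matrix n n ℝ} (hP : P.PosDef) :
    Real.log P.det ≤ P.trace - Fintype.card n := by
  have hdet : P.det = ∏ i, hP.isHermitian.eigenvalues i := by
    simpa using hP.isHermitian.det_eq_prod_eigenvalues
  have htr : P.trace = ∑ i, hP.isHermitian.eigenvalues i := by
    simpa using hP.isHermitian.trace_eq_sum_eigenvalues
  rw [hdet, htr, Real.log_prod fun i _ => (hP.eigenvalues_pos i).ne']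
  calc ∑ i, Real.log (hP.isHermitian.eigenvalues i)
      ≤ ∑ i, (hP.isHermitian.eigenvalues i - 1) :=
        Finset.sum_le_sum fun i _ => Real.log_le_sub_one_of_pos (hP.eigenvalues_pos i)
    _ = _ := by simp [Finset.sum_sub_distrib]

/-- The tangent inequality for `log det` on the positive definite cone, with the inverse of the
base point given in factored form `B * Bᵀ`. -/
theorem Matrix.PosDef.log_det_add_log_det_le {n : Type*} [Fintype n] [DecidableEq n]
    {N : Matrix n n ℝ} (hN : N.PosDef) (B : Matrix n n ℝ) (hB : IsUnit B.det) :
    Real.log N.det + Real.log (B * Bᵀ).det ≤ (N * (B * Bᵀ)).trace - Fintype.card n := by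
  have hinj : Function.Injective B.mulVec :=
    Matrix.mulVec_injective_iff_isUnit.2 ((Matrix.isUnit_iff_isUnit_det B).2 hB)
  have hP : (Bᵀ * N * B).PosDef := by
    simpa [conjTranspose_eq_transpose_of_trivial] using hN.conjTranspose_mul_mul_same hinj
  have hBB : (B * Bᵀ).det ≠ 0 := by simpa using hB.ne_zero
  have hdet : (Bᵀ * N * B).det = N.det * (B * Bᵀ).det := by
    simp only [det_mul, det_transpose]; ring
  have htr : (Bᵀ * N * B).trace = (N * (B * Bᵀ)).trace := by
    rw [Matrix.mul_assoc, trace_mul_comm, Matrix.mul_assoc]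
  have h := hP.log_det_le_trace_sub_card_s9
  rwa [hdet, htr, Real.log_mul hN.det_pos.ne' hBB] at h

/-- The trace of a product against a symmetric matrix is the entrywise inner product. -/
theorem Matrix.IsSymm.trace_mul_eq_sum {n : Type*} [Fintype n] {A : Matrix n n ℝ}
    (hA : A.IsSymm) (N : Matrix n n ℝ) : (N * A).trace = ∑ i, ∑ j, N i j * A i j := by
  simp only [trace, diag_apply, mul_apply]
  exact Finset.sum_congr rfl fun i _ => Finset.sum_congr rfl fun j _ => by rw [hA.apply i j]

/-- Two distinct real matrices have positive squared Frobenius distance. -/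
theorem Matrix.sum_sq_sub_pos {n : Type*} [Fintype n] {N M : Matrix n n ℝ} (h : N ≠ M) :
    0 < ∑ i, ∑ j, (N i j - M i j) ^ 2 := by
  obtain ⟨i, j, hij⟩ : ∃ i j, N i j ≠ M i j := by
    by_contra! hall
    exact h (Matrix.ext hall)
  exact Finset.sum_pos' (fun i _ => Finset.sum_nonneg fun j _ => sq_nonneg _)
    ⟨i, Finset.mem_univ i, Finset.sum_pos' (fun j _ => sq_nonneg _)
      ⟨j, Finset.mem_univ j, by have := sub_ne_zero.2 hij; positivity⟩⟩

/-- Closed-form solution of the first ADMM subproblem: `M = C diag(x) Cᵀ` built from the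
eigendecomposition of `V = S − σE − ρσM₀` is the unique minimizer of
`g(N) = −log det N + tr(N S) + (σ/2)‖N − E‖_F² + (ρσ/2)‖N − M₀‖_F²` over symmetric
positive definite matrices. -/
theorem admm_first_subproblem_unique_min {d : ℕ} (S E M0 : Matrix (Fin d) (Fin d) ℝ)
    (hS : S.IsSymm) (hE : E.IsSymm) (hM0 : M0.IsSymm)
    (σ ρ : ℝ) (hσ : 0 < σ) (hρ : 0 ≤ ρ)
    (c : ℝ) (hc : c = (ρ + 1) * σ)
    (V C : Matrix (Fin d) (Fin d) ℝ) (hV : V = S - σ • E - (ρ * σ) • M0)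
    (v : Fin d → ℝ) (hC : C * Cᵀ = 1) (hC' : Cᵀ * C = 1)
    (hdecomp : V = C * diagonal v * Cᵀ)
    (x : Fin d → ℝ) (hx : ∀ i, x i = (-v i + Real.sqrt (v i ^ 2 + 4 * c)) / (2 * c))
    (M : Matrix (Fin d) (Fin d) ℝ) (hM : M = C * diagonal x * Cᵀ) :
    M.PosDef ∧ ∀ N : Matrix (Fin d) (Fin d) ℝ, N.PosDef → N ≠ M →
      -Real.log M.det + (M * S).trace + σ / 2 * ∑ i, ∑ j, (M i j - E i j) ^ 2
          + ρ * σ / 2 * ∑ i, ∑ j, (M i j - M0 i j) ^ 2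
        < -Real.log N.det + (N * S).trace + σ / 2 * ∑ i, ∑ j, (N i j - E i j) ^ 2
          + ρ * σ / 2 * ∑ i, ∑ j, (N i j - M0 i j) ^ 2 := by
  have hcpos : 0 < c := by rw [hc]; positivity
  have hxpos : ∀ i, 0 < x i := by
    intro i
    rw [hx i]
    have : v i < Real.sqrt (v i ^ 2 + 4 * c) := Real.lt_sqrt_of_sq_lt (by linarith)
    exact div_pos (by linarith) (by linarith)
  have hquad : ∀ i, v i + c * x i = (x i)⁻¹ := by
    intro i
    refine eq_inv_of_mul_eq_one_left ?_
    have hs : Real.sqrt (v i ^ 2 + 4 * c) ^ 2 = v i ^ 2 + 4 * c := Real.sq_sqrt (by positivity)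
    rw [hx i]
    generalize Real.sqrt (v i ^ 2 + 4 * c) = s at hs ⊢
    field_simp
    linear_combination hs
  set B : Matrix (Fin d) (Fin d) ℝ := C * diagonal fun i => (Real.sqrt (x i))⁻¹ with hBdef
  set W : Matrix (Fin d) (Fin d) ℝ := V + c • M with hW
  have hWC : W = C * (diagonal fun i => (x i)⁻¹) * Cᵀ := by
    rw [hW, hdecomp, hM, ← smul_mul_assoc, ← mul_smul_comm, ← add_mul, ← mul_add,
      ← diagonal_smul, diagonal_add]
    congr 3
    ext i
    simpa using hquad i
  have hBB : B * Bᵀ = W := by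
    rw [hWC, hBdef, transpose_mul, diagonal_transpose, Matrix.mul_assoc C,
      ← Matrix.mul_assoc (diagonal _) (diagonal _), diagonal_mul_diagonal, ← Matrix.mul_assoc]
    congr 3
    ext i
    rw [← mul_inv, Real.mul_self_sqrt (hxpos i).le]
  have hMW : M * W = 1 := by
    rw [hWC, hM]
    calc C * diagonal x * Cᵀ * (C * (diagonal fun i => (x i)⁻¹) * Cᵀ)
        = C * (diagonal x * (Cᵀ * C) * diagonal fun i => (x i)⁻¹) * Cᵀ := by
          simp only [Matrix.mul_assoc]
      _ = 1 := by
          rw [hC', Matrix.mul_one, diagonal_mul_diagonal]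
          simp [fun i => mul_inv_cancel₀ (hxpos i).ne', hC]
  have hdet : M.det * W.det = 1 := by rw [← det_mul, hMW, det_one]
  have hBunit : IsUnit B.det := by
    refine isUnit_iff_ne_zero.2 fun h => ?_
    rw [← hBB, det_mul, h] at hdet
    simp at hdet
  have hMpos : M.PosDef := by
    have hCinj : Function.Injective Cᵀ.mulVec :=
      Matrix.mulVec_injective_iff_isUnit.2 (IsUnit.of_mul_eq_one C hC')
    have := (PosDef.diagonal hxpos).conjTranspose_mul_mul_same hCinj
    simpa [conjTranspose_eq_transpose_of_trivial, hM] using this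
  refine ⟨hMpos, fun N hN hNM => ?_⟩
  have hlog := hN.log_det_add_log_det_le B hBunit
  have hlogW : Real.log W.det = -Real.log M.det := by
    rw [eq_inv_of_mul_eq_one_right hdet, Real.log_inv]
  have hWsymm : W.IsSymm := by rw [← hBB]; exact isSymm_mul_transpose_self B
  have htrM : (M * W).trace = Fintype.card (Fin d) := by rw [hMW, trace_one]
  rw [hBB, hlogW, ← htrM, hWsymm.trace_mul_eq_sum, hWsymm.trace_mul_eq_sum] at hlog
  rw [hS.trace_mul_eq_sum, hS.trace_mul_eq_sum]
  have hpos := mul_pos (half_pos hcpos) (sum_sq_sub_pos hNM)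
  have hWij : ∀ i j, W i j = S i j - σ * E i j - ρ * σ * M0 i j + c * M i j := by
    intro i j
    simp [hW, hV]
  have key : c / 2 * ∑ i, ∑ j, (N i j - M i j) ^ 2
        + (∑ i, ∑ j, N i j * W i j - ∑ i, ∑ j, M i j * W i j)
      = (∑ i, ∑ j, N i j * S i j + σ / 2 * ∑ i, ∑ j, (N i j - E i j) ^ 2
          + ρ * σ / 2 * ∑ i, ∑ j, (N i j - M0 i j) ^ 2)
        - (∑ i, ∑ j, M i j * S i j + σ / 2 * ∑ i, ∑ j, (M i j - E i j) ^ 2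
          + ρ * σ / 2 * ∑ i, ∑ j, (M i j - M0 i j) ^ 2) := by
    simp only [Finset.mul_sum, ← Finset.sum_add_distrib, ← Finset.sum_sub_distrib]
    refine Finset.sum_congr rfl fun i _ => Finset.sum_congr rfl fun j _ => ?_
    rw [hWij, hc]
    ring
  linarith
end

section
/- Let l ≤ 0 ≤ u and c > 0 be real numbers and a ∈ ℝ. Then the function h(x) = max{l x, u x} + (c/2)(x − a)² has the unique minimizer over ℝ given by x* = min{a − l/c, 0} + max{a − u/c, 0}. -/
/-- A slope between `l` and `u` is a subgradient at `0` of `x ↦ max (l * x) (u * x)`. -/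
theorem mul_le_max_mul_of_mem_Icc {l u s : ℝ} (hs : s ∈ Set.Icc l u) (x : ℝ) :
    s * x ≤ max (l * x) (u * x) := by
  rcases le_total 0 x with hx | hx
  · exact le_max_of_le_right (mul_le_mul_of_nonneg_right hs.2 hx)
  · exact le_max_of_le_left (mul_le_mul_of_nonpos_right hs.1 hx)

/-- The optimality condition for the proximal point `p` of `x ↦ max (l * x) (u * x)`:
`c * (a - p)` is a subgradient at `p`. -/
theorem golazo_prox_subgradient {l u c a p : ℝ} (hl : l ≤ 0) (hu : 0 ≤ u) (hc : 0 < c)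
    (hp : p = min (a - l / c) 0 + max (a - u / c) 0) :
    c * (a - p) ∈ Set.Icc l u ∧ max (l * p) (u * p) = c * (a - p) * p := by
  have hL : l / c ≤ 0 := div_nonpos_of_nonpos_of_nonneg hl hc.le
  have hU : 0 ≤ u / c := div_nonneg hu hc.le
  have hcl : c * (l / c) = l := mul_div_cancel₀ l hc.ne'
  have hcu : c * (u / c) = u := mul_div_cancel₀ u hc.ne'
  rcases le_total a (l / c) with h | h
  · rw [min_eq_left (by linarith), max_eq_right (by linarith), add_zero] at hp
    have hs : c * (a - p) = l := by rw [hp, sub_sub_cancel, hcl]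
    rw [hs]
    exact ⟨⟨le_rfl, hl.trans hu⟩,
      max_eq_left (mul_le_mul_of_nonpos_right (hl.trans hu) (by linarith))⟩
  rcases le_total (u / c) a with h' | h'
  · rw [min_eq_right (by linarith), max_eq_left (by linarith), zero_add] at hp
    have hs : c * (a - p) = u := by rw [hp, sub_sub_cancel, hcu]
    rw [hs]
    exact ⟨⟨hl.trans hu, le_rfl⟩,
      max_eq_right (mul_le_mul_of_nonneg_right (hl.trans hu) (by linarith))⟩
  · rw [min_eq_right (by linarith), max_eq_right (by linarith), add_zero] at hp
    subst hp
    refine ⟨⟨?_, ?_⟩, by simp⟩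
    · rw [sub_zero, ← hcl]
      exact mul_le_mul_of_nonneg_left h hc.le
    · rw [sub_zero, ← hcu]
      exact mul_le_mul_of_nonneg_left h' hc.le

/-- The scalar Golazo proximal problem: for `l ≤ 0 ≤ u` and `c > 0`, the function
`h(x) = max {l x, u x} + (c/2)(x − a)²` has the unique minimizer
`x* = min {a − l/c, 0} + max {a − u/c, 0}`. -/
theorem scalar_golazo_prox (l u c a : ℝ) (hl : l ≤ 0) (hu : 0 ≤ u) (hc : 0 < c) :
    ∀ x : ℝ, x ≠ min (a - l / c) 0 + max (a - u / c) 0 →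
      max (l * (min (a - l / c) 0 + max (a - u / c) 0))
          (u * (min (a - l / c) 0 + max (a - u / c) 0))
        + c / 2 * ((min (a - l / c) 0 + max (a - u / c) 0) - a) ^ 2
      < max (l * x) (u * x) + c / 2 * (x - a) ^ 2 := by
  intro x hx
  generalize hp : min (a - l / c) 0 + max (a - u / c) 0 = p at hx ⊢
  obtain ⟨hs, hmax⟩ := golazo_prox_subgradient hl hu hc hp.symm
  have hle := mul_le_max_mul_of_mem_Icc hs x
  have hpos : 0 < c / 2 * (x - p) ^ 2 :=
    mul_pos (half_pos hc) (sq_pos_of_ne_zero (sub_ne_zero.mpr hx))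
  rw [hmax]
  nlinarith only [hle, hpos]
end

section
/- Let L, U be real d×d matrices with L_{ij} ≤ 0 ≤ U_{ij} for all i, j, let c > 0, and let Y be a real d×d matrix. Then the matrix A* with entries A*_{ij} = min{Y_{ij} − L_{ij}/c, 0} + max{Y_{ij} − U_{ij}/c, 0} is the unique minimizer over all real d×d matrices A of the function A ↦ ‖A‖_{LU} + (c/2) Σ_{i,j} (A_{ij} − Y_{ij})². -/
lemma mul_le_max_mul {l u g : ℝ} (hl : l ≤ g) (hu : g ≤ u) (x : ℝ) :
    g * x ≤ max (l * x) (u * x) := by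
  rcases le_total 0 x with hx | hx
  · exact le_max_of_le_right (mul_le_mul_of_nonneg_right hu hx)
  · exact le_max_of_le_left (mul_le_mul_of_nonpos_right hl hx)

/-- At the scalar Golazo proximal point `a`, the number `c * (y - a)` is a subgradient of
`x ↦ max (l * x) (u * x)`. -/
lemma golazo_scalar_subgradient {l u c y a : ℝ} (hl : l ≤ 0) (hu : 0 ≤ u) (hc : 0 < c)
    (ha : a = min (y - l / c) 0 + max (y - u / c) 0) :
    l ≤ c * (y - a) ∧ c * (y - a) ≤ u ∧ max (l * a) (u * a) = c * (y - a) * a := by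
  have hl' : l / c ≤ 0 := div_nonpos_of_nonpos_of_nonneg hl hc.le
  have hu' : 0 ≤ u / c := div_nonneg hu hc.le
  have hcl : c * (l / c) = l := mul_div_cancel₀ l hc.ne'
  have hcu : c * (u / c) = u := mul_div_cancel₀ u hc.ne'
  rcases lt_or_ge y (l / c) with h₁ | h₁
  · have ha' : a = y - l / c := by
      rw [ha, min_eq_left (by linarith), max_eq_right (by linarith), add_zero]
    have hg : c * (y - a) = l := by rw [ha', sub_sub_cancel, hcl]
    rw [hg]
    exact ⟨le_rfl, by linarith,
      max_eq_left (mul_le_mul_of_nonpos_right (by linarith) (by linarith))⟩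
  rcases lt_or_ge (u / c) y with h₂ | h₂
  · have ha' : a = y - u / c := by
      rw [ha, min_eq_right (by linarith), max_eq_left (by linarith), zero_add]
    have hg : c * (y - a) = u := by rw [ha', sub_sub_cancel, hcu]
    rw [hg]
    exact ⟨by linarith, le_rfl,
      max_eq_right (mul_le_mul_of_nonneg_right (by linarith) (by linarith))⟩
  · have ha' : a = 0 := by
      rw [ha, min_eq_right (by linarith), max_eq_right (by linarith), add_zero]
    have hlc := mul_le_mul_of_nonneg_left h₁ hc.le
    have huc := mul_le_mul_of_nonneg_left h₂ hc.le
    rw [ha', sub_zero]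
    exact ⟨by linarith, by linarith, by simp⟩

/-- Quadratic growth of the scalar Golazo proximal objective around its minimizer. -/
lemma golazo_scalar_prox_growth {l u c y a : ℝ} (hl : l ≤ 0) (hu : 0 ≤ u) (hc : 0 < c)
    (ha : a = min (y - l / c) 0 + max (y - u / c) 0) (x : ℝ) :
    max (l * a) (u * a) + c / 2 * (a - y) ^ 2 + c / 2 * (x - a) ^ 2
      ≤ max (l * x) (u * x) + c / 2 * (x - y) ^ 2 := by
  obtain ⟨hlg, hgu, hmax⟩ := golazo_scalar_subgradient hl hu hc ha
  have hx := mul_le_max_mul hlg hgu x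
  rw [hmax]
  linear_combination hx

lemma golazo_add_sum_sq {d : ℕ} (L U Y A : Matrix (Fin d) (Fin d) ℝ) (c : ℝ) :
    golazo L U A + c / 2 * ∑ i, ∑ j, (A i j - Y i j) ^ 2
      = ∑ i, ∑ j, (max (L i j * A i j) (U i j * A i j) + c / 2 * (A i j - Y i j) ^ 2) := by
  simp only [golazo, Finset.mul_sum, Finset.sum_add_distrib]

/-- Closed-form solution of the second ADMM subproblem: the entrywise soft-thresholding-type
matrix `A*` is the unique minimizer of `A ↦ ‖A‖_{LU} + (c/2) ∑_{i,j} (A_{ij} − Y_{ij})²`. -/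
theorem golazo_prox_matrix {d : ℕ} (L U : Matrix (Fin d) (Fin d) ℝ)
    (hL : ∀ i j, L i j ≤ 0) (hU : ∀ i j, 0 ≤ U i j)
    (c : ℝ) (hc : 0 < c) (Y : Matrix (Fin d) (Fin d) ℝ)
    (Astar : Matrix (Fin d) (Fin d) ℝ)
    (hAstar : ∀ i j, Astar i j = min (Y i j - L i j / c) 0 + max (Y i j - U i j / c) 0) :
    ∀ A : Matrix (Fin d) (Fin d) ℝ, A ≠ Astar →
      golazo L U Astar + c / 2 * ∑ i, ∑ j, (Astar i j - Y i j) ^ 2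
        < golazo L U A + c / 2 * ∑ i, ∑ j, (A i j - Y i j) ^ 2 := by
  intro A hA
  have hle : ∀ i j, max (L i j * Astar i j) (U i j * Astar i j)
      + c / 2 * (Astar i j - Y i j) ^ 2 + c / 2 * (A i j - Astar i j) ^ 2
      ≤ max (L i j * A i j) (U i j * A i j) + c / 2 * (A i j - Y i j) ^ 2 := fun i j =>
    golazo_scalar_prox_growth (hL i j) (hU i j) hc (hAstar i j) (A i j)
  have hsq : ∀ i j, 0 ≤ c / 2 * (A i j - Astar i j) ^ 2 := fun i j => by positivity
  obtain ⟨i, j, hij⟩ : ∃ i j, A i j ≠ Astar i j := by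
    by_contra! h
    exact hA (Matrix.ext h)
  have hpos : 0 < c / 2 * (A i j - Astar i j) ^ 2 :=
    mul_pos (half_pos hc) (sq_pos_of_ne_zero (sub_ne_zero.mpr hij))
  rw [golazo_add_sum_sq, golazo_add_sum_sq]
  refine Finset.sum_lt_sum
    (fun k _ => Finset.sum_le_sum fun m _ => by linarith [hle k m, hsq k m])
    ⟨i, Finset.mem_univ i, Finset.sum_lt_sum (fun m _ => by linarith [hle i m, hsq i m])
      ⟨j, Finset.mem_univ j, by linarith [hle i j]⟩⟩
end

section
/- Let Γ be a symmetric real d×d matrix with zero diagonal such that v^T Γ v < 0 for every nonzero v ∈ ℝ^d with 𝟏^T v = 0. Then the (d+1)×(d+1) bordered matrix with blocks [[−Γ/2, 𝟏], [𝟏^T, 0]] is invertible, and if Θ denotes the top-left d×d block of its inverse, then Θ is symmetric, Θ 𝟏 = 0, and Θ is positive semidefinite. -/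
open Matrix

/-- Bordering a matrix that is positive definite on the sum-zero vectors by a row and a column of
ones gives an invertible matrix. -/
theorem isUnit_det_bordered {ι : Type*} [Fintype ι] [DecidableEq ι] [Nonempty ι]
    (A : Matrix ι ι ℝ)
    (hA : ∀ v : ι → ℝ, v ≠ 0 → ∑ i, v i = 0 → 0 < v ⬝ᵥ (A *ᵥ v)) :
    IsUnit (fromBlocks A (of fun _ _ => (1 : ℝ)) (of fun _ _ => (1 : ℝ))
      (0 : Matrix (Fin 1) (Fin 1) ℝ)).det := by
  rw [isUnit_iff_ne_zero]
  intro hdet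
  obtain ⟨w, hw, hMw⟩ := exists_mulVec_eq_zero_iff.mpr hdet
  rw [fromBlocks_mulVec] at hMw
  have htop (i : ι) : (A *ᵥ (w ∘ Sum.inl)) i + w (Sum.inr 0) = 0 := by
    simpa [mulVec, dotProduct] using congrFun hMw (Sum.inl i)
  have hsum : ∑ i, (w ∘ Sum.inl) i = 0 := by
    simpa [mulVec, dotProduct] using congrFun hMw (Sum.inr 0)
  have hv : w ∘ Sum.inl = 0 := by
    by_contra hv
    refine (hA _ hv hsum).ne' ?_
    rw [show A *ᵥ (w ∘ Sum.inl) = fun _ => -w (Sum.inr 0) from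
      funext fun i => eq_neg_of_add_eq_zero_left (htop i)]
    simp only [dotProduct, ← Finset.sum_mul, hsum, zero_mul]
  have hc : w (Sum.inr 0) = 0 := by
    simpa [hv] using htop (Classical.arbitrary ι)
  refine hw (funext ?_)
  rintro (i | i)
  · exact congrFun hv i
  · rwa [Subsingleton.elim i 0]

/-- The top-left block `Θ` of the inverse of a symmetric bordered matrix is symmetric, is killed by
the bordering column, and satisfies `Θ A Θ = Θ`. -/
theorem toBlocks₁₁_inv_bordered {ι κ R : Type*} [Fintype ι] [DecidableEq ι] [Fintype κ]
    [DecidableEq κ] [CommRing R] {A : Matrix ι ι R} {B : Matrix ι κ R} (hA : A.IsSymm)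
    (h : IsUnit (fromBlocks A B Bᵀ 0).det) :
    (fromBlocks A B Bᵀ 0)⁻¹.toBlocks₁₁.IsSymm ∧
    (fromBlocks A B Bᵀ 0)⁻¹.toBlocks₁₁ * B = 0 ∧
    (fromBlocks A B Bᵀ 0)⁻¹.toBlocks₁₁ * A * (fromBlocks A B Bᵀ 0)⁻¹.toBlocks₁₁ =
      (fromBlocks A B Bᵀ 0)⁻¹.toBlocks₁₁ := by
  set M := fromBlocks A B Bᵀ 0 with hM
  have hMsymm : M.IsSymm := hA.fromBlocks rfl isSymm_zero
  have hsymm : M⁻¹.toBlocks₁₁.IsSymm := by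
    ext i j
    exact hMsymm.inv.apply (Sum.inl i) (Sum.inl j)
  have hmul := nonsing_inv_mul M h
  rw [← fromBlocks_toBlocks M⁻¹, hM, fromBlocks_multiply, ← hM, ← fromBlocks_one,
    fromBlocks_inj] at hmul
  obtain ⟨h₁₁, h₁₂, -, -⟩ := hmul
  rw [Matrix.mul_zero, add_zero] at h₁₂
  have hB : Bᵀ * M⁻¹.toBlocks₁₁ = 0 := by
    have := congrArg transpose h₁₂
    rwa [transpose_mul, hsymm.eq, transpose_zero] at this
  refine ⟨hsymm, h₁₂, ?_⟩
  rw [eq_sub_of_add_eq h₁₁, Matrix.sub_mul, Matrix.mul_assoc, hB, Matrix.mul_zero, sub_zero,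
    Matrix.one_mul]

/-- The Fiedler–Bapat identity: for a conditionally negative definite variogram matrix `Γ`
(with zero diagonal), the bordered matrix `[[−Γ/2, 𝟏], [𝟏ᵀ, 0]]` is invertible, and the
top-left `d × d` block `Θ` of its inverse is a symmetric positive semidefinite matrix with
`Θ 𝟏 = 0`. -/
theorem fiedler_bapat {d : ℕ} (hd : 1 ≤ d)
    (Γ : Matrix (Fin d) (Fin d) ℝ) (hΓsymm : Γ.IsSymm)
    (hΓdiag : ∀ i, Γ i i = 0)
    (hΓcnd : ∀ v : Fin d → ℝ, v ≠ 0 → ∑ i, v i = 0 → v ⬝ᵥ (Γ *ᵥ v) < 0) :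
    IsUnit (Matrix.fromBlocks (-(1 / 2 : ℝ) • Γ)
        (Matrix.of fun _ _ => (1 : ℝ)) (Matrix.of fun _ _ => (1 : ℝ))
        (0 : Matrix (Fin 1) (Fin 1) ℝ)).det ∧
    (Matrix.of fun i j => (Matrix.fromBlocks (-(1 / 2 : ℝ) • Γ)
        (Matrix.of fun _ _ => (1 : ℝ)) (Matrix.of fun _ _ => (1 : ℝ))
        (0 : Matrix (Fin 1) (Fin 1) ℝ))⁻¹ (Sum.inl i) (Sum.inl j)).IsSymm ∧
    (Matrix.of fun i j => (Matrix.fromBlocks (-(1 / 2 : ℝ) • Γ)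
        (Matrix.of fun _ _ => (1 : ℝ)) (Matrix.of fun _ _ => (1 : ℝ))
        (0 : Matrix (Fin 1) (Fin 1) ℝ))⁻¹ (Sum.inl i) (Sum.inl j)) *ᵥ (fun _ => (1 : ℝ)) = 0 ∧
    (Matrix.of fun i j => (Matrix.fromBlocks (-(1 / 2 : ℝ) • Γ)
        (Matrix.of fun _ _ => (1 : ℝ)) (Matrix.of fun _ _ => (1 : ℝ))
        (0 : Matrix (Fin 1) (Fin 1) ℝ))⁻¹ (Sum.inl i) (Sum.inl j)).PosSemidef := by
  have : Nonempty (Fin d) := ⟨⟨0, hd⟩⟩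
  have hpos (v : Fin d → ℝ) (hv : v ≠ 0) (hsum : ∑ i, v i = 0) :
      0 < v ⬝ᵥ ((-(1 / 2 : ℝ) • Γ) *ᵥ v) := by
    rw [smul_mulVec, dotProduct_smul, smul_eq_mul]
    linarith [hΓcnd v hv hsum]
  have hunit := isUnit_det_bordered _ hpos
  obtain ⟨hsymm, hone, hidem⟩ := toBlocks₁₁_inv_bordered
    (B := of fun _ (_ : Fin 1) => (1 : ℝ)) (hΓsymm.smul (-(1 / 2 : ℝ))) hunit
  have hker := congrArg (fun N : Matrix (Fin d) (Fin 1) ℝ => N.col 0) hone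
  refine ⟨hunit, hsymm, hker, ?_⟩
  refine PosSemidef.of_dotProduct_mulVec_nonneg (by
    rw [IsHermitian, conjTranspose_eq_transpose_of_trivial]; exact hsymm) fun x => ?_
  set Θ := (fromBlocks (-(1 / 2 : ℝ) • Γ) (of fun _ (_ : Fin 1) => (1 : ℝ))
    (of fun _ (_ : Fin 1) => (1 : ℝ))ᵀ 0)⁻¹.toBlocks₁₁
  change 0 ≤ star x ⬝ᵥ (Θ *ᵥ x)
  have hsum : ∑ i, (Θ *ᵥ x) i = 0 := by
    have hcol : Θ *ᵥ (fun _ => (1 : ℝ)) = 0 := hker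
    calc ∑ i, (Θ *ᵥ x) i = (fun _ => (1 : ℝ)) ⬝ᵥ (Θ *ᵥ x) := by simp [dotProduct]
      _ = 0 := by
        rw [dotProduct_mulVec, ← mulVec_transpose, hsymm.eq, hcol, zero_dotProduct]
  have hquad : star x ⬝ᵥ (Θ *ᵥ x) = (Θ *ᵥ x) ⬝ᵥ ((-(1 / 2 : ℝ) • Γ) *ᵥ (Θ *ᵥ x)) := by
    conv_lhs => rw [← hidem]
    rw [star_trivial, ← mulVec_mulVec, ← mulVec_mulVec, dotProduct_mulVec, ← mulVec_transpose,
      hsymm.eq]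
  rw [hquad]
  rcases eq_or_ne (Θ *ᵥ x) 0 with h | h
  · rw [h, zero_dotProduct]
  · exact (hpos _ h hsum).le
end
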